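/- arXiv:math/0506388 — 4 statements merged into one kernel-verified Lean document; each statement's English description precedes it below -/
import Mathlib

section
/- The j-invariant of the Weierstrass curve W over ℚ(t) given by y² + (1+t−t²)xy + (t²−t³)y = x³ + (t²−t³)x² equals (t²−t+1)³(t⁶−11t⁵+30t⁴−15t³−10t²+5t+1)³ / (t⁷(t−1)⁷(t³−8t²+5t+1)); that is, Δ ≠ 0 and c₄³/Δ equals this rational function in ℚ(t). -/
/-- `t` : the generator of the rational function field `ℚ(t)`. -/
noncomputable def t : RatFunc ℚ := RatFunc.X

/-- Tate's universal elliptic curve with a point of order 7 (associated to `Γ₁(7)`):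
`y² + (1+t−t²)xy + (t²−t³)y = x³ + (t²−t³)x²` over `ℚ(t)`. -/
noncomputable def W : WeierstrassCurve (RatFunc ℚ) :=
  { a₁ := 1 + t - t ^ 2, a₂ := t ^ 2 - t ^ 3, a₃ := t ^ 2 - t ^ 3, a₄ := 0, a₆ := 0 }

/-- A nonzero polynomial stays nonzero when viewed as a rational function in `t`. -/
theorem map_ne_zero_of_coeff (p : Polynomial ℚ) (n : ℕ) (h : p.coeff n ≠ 0) :
    algebraMap (Polynomial ℚ) (RatFunc ℚ) p ≠ 0 := by
  intro h0
  apply h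
  have : p = 0 := RatFunc.algebraMap_injective ℚ (by rw [h0, map_zero])
  rw [this, Polynomial.coeff_zero]

theorem t_ne : t ≠ 0 := RatFunc.X_ne_zero

theorem t_sub_one_ne : t - 1 ≠ 0 := by
  have h := map_ne_zero_of_coeff (Polynomial.X - 1) 0 (by simp)
  simpa [t] using h

theorem cubic_ne : t ^ 3 - 8 * t ^ 2 + 5 * t + 1 ≠ 0 := by
  have h := map_ne_zero_of_coeff
    (Polynomial.X ^ 3 - 8 * Polynomial.X ^ 2 + 5 * Polynomial.X + 1) 0
    (by simp)
  have h8 : algebraMap (Polynomial ℚ) (RatFunc ℚ) 8 = 8 := map_ofNat _ 8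
  have h5 : algebraMap (Polynomial ℚ) (RatFunc ℚ) 5 = 5 := map_ofNat _ 5
  simpa [t, h8, h5] using h

theorem W_disc : W.Δ = t ^ 7 * (t - 1) ^ 7 * (t ^ 3 - 8 * t ^ 2 + 5 * t + 1) := by
  simp only [W, WeierstrassCurve.Δ, WeierstrassCurve.b₂, WeierstrassCurve.b₄,
    WeierstrassCurve.b₆, WeierstrassCurve.b₈]
  ring

theorem W_c4 : W.c₄ = (t ^ 2 - t + 1) *
    (t ^ 6 - 11 * t ^ 5 + 30 * t ^ 4 - 15 * t ^ 3 - 10 * t ^ 2 + 5 * t + 1) := by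
  simp only [W, WeierstrassCurve.c₄, WeierstrassCurve.b₂, WeierstrassCurve.b₄]
  ring

/-- The j-invariant `c₄³/Δ` of Tate's `Γ₁(7)` curve equals
`(t²−t+1)³(t⁶−11t⁵+30t⁴−15t³−10t²+5t+1)³ / (t⁷(t−1)⁷(t³−8t²+5t+1))`. -/
theorem j_invariant_of_Gamma1_7_curve :
    W.Δ ≠ 0 ∧
    W.c₄ ^ 3 / W.Δ =
      (t ^ 2 - t + 1) ^ 3 *
        (t ^ 6 - 11 * t ^ 5 + 30 * t ^ 4 - 15 * t ^ 3 - 10 * t ^ 2 + 5 * t + 1) ^ 3 /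
      (t ^ 7 * (t - 1) ^ 7 * (t ^ 3 - 8 * t ^ 2 + 5 * t + 1)) := by
  refine ⟨?_, ?_⟩
  · rw [W_disc]
    exact mul_ne_zero (mul_ne_zero (pow_ne_zero _ t_ne) (pow_ne_zero _ t_sub_one_ne)) cubic_ne
  · rw [W_disc, W_c4, mul_pow]
end

section
/- The polynomial 4X³ + (T⁴−6T³+3T²+2T+1)X² + 2T²(T³−2T²+1)X + T⁴(T−1)² is irreducible in the polynomial ring ℚ[T,X]. -/
open MvPolynomial

/-- The variable `T` in `ℚ[T,X]`. -/
noncomputable def T' : MvPolynomial (Fin 2) ℚ := X 0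

/-- The variable `X` in `ℚ[T,X]`. -/
noncomputable def X' : MvPolynomial (Fin 2) ℚ := X 1

/-- The cubic at `T = 2` has no rational root. -/
lemma no_rat_root (q : ℚ) (h : q ^ 3 + (-15 / 4) * q ^ 2 + 2 * q + 4 = 0) : False := by
  have hy : (4 * q) ^ 3 - 15 * (4 * q) ^ 2 + 32 * (4 * q) + 256 = 0 := by
    linear_combination 64 * h
  have hint : IsIntegral ℤ (4 * q) := by
    refine ⟨Polynomial.X ^ 3 + (Polynomial.C (-15) * Polynomial.X ^ 2
      + Polynomial.C 32 * Polynomial.X + Polynomial.C 256), ?_, ?_⟩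
    · apply Polynomial.monic_X_pow_add
      compute_degree!
    · simp only [Polynomial.eval₂_add, Polynomial.eval₂_mul, Polynomial.eval₂_pow,
        Polynomial.eval₂_X, Polynomial.eval₂_C]
      simp only [eq_intCast]
      push_cast
      linear_combination hy
  obtain ⟨y, hyq⟩ := IsIntegrallyClosed.isIntegral_iff.mp hint
  rw [← hyq] at hy
  simp only [eq_intCast] at hy
  have hz : y ^ 3 - 15 * y ^ 2 + 32 * y + 256 = 0 := by exact_mod_cast hy
  have h3 := congrArg (Int.cast : ℤ → ZMod 3) hz
  push_cast at h3
  generalize (y : ZMod 3) = w at h3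
  revert h3
  revert w
  decide

/-- `ℚ[T,X]` as polynomials in `X` over `ℚ[T]`. -/
noncomputable def asPolyX :
    MvPolynomial (Fin 2) ℚ ≃ₐ[ℚ] Polynomial (MvPolynomial (Fin 1) ℚ) :=
  (MvPolynomial.renameEquiv ℚ (Equiv.swap (0 : Fin 2) 1)).trans (MvPolynomial.finSuccEquiv ℚ 1)

lemma asPolyX_X : asPolyX X' = Polynomial.X := by
  simp [asPolyX, X', MvPolynomial.finSuccEquiv_X_zero]

lemma asPolyX_T : asPolyX T' = Polynomial.C (MvPolynomial.X 0) := by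
  have := MvPolynomial.finSuccEquiv_X_succ (R := ℚ) (n := 1) (j := 0)
  simpa [asPolyX, T'] using this

/-- A cubic, made monic, specialises to an irreducible cubic at `T = 2`. -/
lemma irreducible_monic_cubic (a b c : MvPolynomial (Fin 1) ℚ)
    (ha : MvPolynomial.eval (fun _ => (2 : ℚ)) a = -15 / 4)
    (hb : MvPolynomial.eval (fun _ => (2 : ℚ)) b = 2)
    (hc : MvPolynomial.eval (fun _ => (2 : ℚ)) c = 4) :
    Irreducible (Polynomial.X ^ 3 + (Polynomial.C a * Polynomial.X ^ 2
      + Polynomial.C b * Polynomial.X + Polynomial.C c)) := by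
  apply Polynomial.Monic.irreducible_of_irreducible_map (MvPolynomial.eval (fun _ => (2 : ℚ)))
  · apply Polynomial.monic_X_pow_add
    compute_degree!
  · simp only [Polynomial.map_add, Polynomial.map_mul, Polynomial.map_pow, Polynomial.map_X,
      Polynomial.map_C, ha, hb, hc]
    have hd : (Polynomial.X ^ 3 + (Polynomial.C (-15 / 4 : ℚ) * Polynomial.X ^ 2
      + Polynomial.C 2 * Polynomial.X + Polynomial.C 4)).natDegree = 3 := by
      compute_degree!
    apply Polynomial.irreducible_of_degree_le_three_of_not_isRoot
    · rw [hd]; decide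
    · intro q hq
      apply no_rat_root q
      simp only [Polynomial.IsRoot.def, Polynomial.eval_add, Polynomial.eval_mul,
        Polynomial.eval_pow, Polynomial.eval_X, Polynomial.eval_C] at hq
      linear_combination hq

/-- The polynomial `4X³ + (T⁴−6T³+3T²+2T+1)X² + 2T²(T³−2T²+1)X + T⁴(T−1)²`, which defines
the curve `B` of non-zero 2-torsion points of Tate's `Γ₁(7)` curve, is irreducible in
`ℚ[T,X]`. -/
theorem two_torsion_curve_irreducible :
    Irreducible
      (4 * X' ^ 3
        + (T' ^ 4 - 6 * T' ^ 3 + 3 * T' ^ 2 + 2 * T' + 1) * X' ^ 2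
        + 2 * T' ^ 2 * (T' ^ 3 - 2 * T' ^ 2 + 1) * X'
        + T' ^ 4 * (T' - 1) ^ 2) := by
  rw [← MulEquiv.irreducible_iff asPolyX]
  simp only [map_add, map_mul, map_sub, map_pow, map_ofNat, map_one, asPolyX_X, asPolyX_T]
  have key := irreducible_monic_cubic
    (MvPolynomial.C (1 / 4) * (X 0 ^ 4 - 6 * X 0 ^ 3 + 3 * X 0 ^ 2 + 2 * X 0 + 1))
    (MvPolynomial.C (1 / 4) * (2 * X 0 ^ 2 * (X 0 ^ 3 - 2 * X 0 ^ 2 + 1)))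
    (MvPolynomial.C (1 / 4) * (X 0 ^ 4 * (X 0 - 1) ^ 2))
    (by simp; norm_num) (by simp; norm_num) (by simp; norm_num)
  have h4 : (4 : Polynomial (MvPolynomial (Fin 1) ℚ))
      * Polynomial.C (MvPolynomial.C (1 / 4)) = 1 := by
    have : (4 : Polynomial (MvPolynomial (Fin 1) ℚ))
      = Polynomial.C (MvPolynomial.C 4) := by simp only [map_ofNat]
    rw [this, ← map_mul, ← map_mul]
    norm_num
  have hu : IsUnit (4 : Polynomial (MvPolynomial (Fin 1) ℚ)) := IsUnit.of_mul_eq_one _ h4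
  rw [← irreducible_isUnit_mul hu] at key
  convert key using 1
  simp only [map_add, map_mul, map_sub, map_pow, map_ofNat, map_one]
  generalize Polynomial.C (MvPolynomial.C (1 / 4 : ℚ)) = k at h4
  generalize Polynomial.C (X 0 : MvPolynomial (Fin 1) ℚ) = t
  linear_combination (-((t ^ 4 - 6 * t ^ 3 + 3 * t ^ 2 + 2 * t + 1) * Polynomial.X ^ 2
    + 2 * t ^ 2 * (t ^ 3 - 2 * t ^ 2 + 1) * Polynomial.X + t ^ 4 * (t - 1) ^ 2)) * h4
end

section
/- In the polynomial ring ℚ(t)[X,Y,Z] there exists a nonzero element c ∈ ℚ(t) such that substituting x = t²·X, y = t²(t−1)·Y, z = X/(t−1) + Y + Z into the homogeneous cubic G(x,y,z) = y²z + (1+t−t²)xyz + (t²−t³)yz² − x³ − (t²−t³)x²z (the projectivization of Tate's Γ₁(7) curve) yields c · F(X,Y,Z), where F(X,Y,Z) = t(t−1)·X(X−Y)(Y+Z) + (t−1)(X−Y−Z)YZ + t(X−Y)XZ. -/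
open MvPolynomial

/-- The homogeneous cubic `G(x,y,z) = y²z + (1+t−t²)xyz + (t²−t³)yz² − x³ − (t²−t³)x²z`
(the projectivization of Tate's `Γ₁(7)` curve), as a function of three polynomials. -/
noncomputable def G (x y z : MvPolynomial (Fin 3) (RatFunc ℚ)) :
    MvPolynomial (Fin 3) (RatFunc ℚ) :=
  y ^ 2 * z + C (1 + t - t ^ 2) * x * y * z + C (t ^ 2 - t ^ 3) * y * z ^ 2
    - x ^ 3 - C (t ^ 2 - t ^ 3) * x ^ 2 * z

/-- The cubic `F(X,Y,Z) = t(t−1)·X(X−Y)(Y+Z) + (t−1)(X−Y−Z)YZ + t(X−Y)XZ` in `ℚ(t)[X,Y,Z]`. -/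
noncomputable def F : MvPolynomial (Fin 3) (RatFunc ℚ) :=
  C (t * (t - 1)) * (X 0 * (X 0 - X 1) * (X 1 + X 2))
    + C (t - 1) * ((X 0 - X 1 - X 2) * X 1 * X 2)
    + C t * ((X 0 - X 1) * X 0 * X 2)

/-- Substituting `x = t²·X`, `y = t²(t−1)·Y`, `z = X/(t−1) + Y + Z` into the homogeneous
cubic `G` yields a nonzero constant multiple of `F`. -/
theorem change_of_variables_to_F :
    ∃ c : RatFunc ℚ, c ≠ 0 ∧
      G (C (t ^ 2) * X 0) (C (t ^ 2 * (t - 1)) * X 1)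
          (C ((t - 1)⁻¹) * X 0 + X 1 + X 2)
        = C c * F := by
  have h1 : t - 1 ≠ 0 := by
    intro h
    have h2 : (RatFunc.X : RatFunc ℚ) = RatFunc.C 1 := by
      rw [map_one]; exact sub_eq_zero.mp h
    rw [← RatFunc.algebraMap_X, ← RatFunc.algebraMap_C] at h2
    have h3 := RatFunc.algebraMap_injective ℚ h2
    exact Polynomial.X_ne_C 1 h3
  have h0 : t ≠ 0 := RatFunc.X_ne_zero
  refine ⟨t ^ 4 * (t - 1), mul_ne_zero (pow_ne_zero _ h0) h1, ?_⟩
  have h : ((C t - 1) * C ((t - 1)⁻¹) : MvPolynomial (Fin 3) (RatFunc ℚ)) = 1 := by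
    rw [← C_1, ← C_sub, ← C_mul, mul_inv_cancel₀ h1]
  unfold G F
  simp only [C_mul, C_sub, C_add, C_pow, C_1]
  generalize (C ((t - 1)⁻¹) : MvPolynomial (Fin 3) (RatFunc ℚ)) = U at *
  generalize (C t : MvPolynomial (Fin 3) (RatFunc ℚ)) = T at *
  linear_combination (T ^ 6 * X 0 ^ 3 + (1 + T - T ^ 2) * T ^ 4 * X 0 ^ 2 * X 1
    - T ^ 4 * ((T - 1) * U + 1) * X 0 ^ 2 * X 1 - T ^ 4 * (T - 1) * X 0 * X 1 ^ 2
    - 2 * T ^ 4 * (T - 1) * X 0 * X 1 * X 2) * h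
end

section
/- In the field ℚ(t), setting r = (t³ − 8t² + 5t + 1)/(49·t(t−1)), the following identity of rational functions holds: (2401r² + 245r + 1)³ · (49r² + 13r + 1) / r = (t²−t+1)³(t⁶−11t⁵+30t⁴−15t³−10t²+5t+1)³ / (t⁷(t−1)⁷(t³−8t²+5t+1)). -/
theorem tower_aux {K : Type*} [Field K] [CharZero K] (t : K) (p q r : K)
    (hp : p = t ^ 3 - 8 * t ^ 2 + 5 * t + 1) (hq : q = t * (t - 1)) (hr : r = p / (49 * q)) :
    (2401 * r ^ 2 + 245 * r + 1) ^ 3 * (49 * r ^ 2 + 13 * r + 1) / r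
      = (t ^ 2 - t + 1) ^ 3 *
          (t ^ 6 - 11 * t ^ 5 + 30 * t ^ 4 - 15 * t ^ 3 - 10 * t ^ 2 + 5 * t + 1) ^ 3 /
        (q ^ 7 * p) := by
  have h1 : t ^ 6 - 11 * t ^ 5 + 30 * t ^ 4 - 15 * t ^ 3 - 10 * t ^ 2 + 5 * t + 1
      = p ^ 2 + 5 * p * q + q ^ 2 := by
    rw [hp, hq]; ring
  have h2 : (t ^ 2 - t + 1) ^ 3 = p ^ 2 + 13 * p * q + 49 * q ^ 2 := by
    rw [hp, hq]; ring
  rw [h1, h2]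
  clear h1 h2 hp hq
  by_cases hp0 : p = 0
  · simp [hr, hp0]
  by_cases hq0 : q = 0
  · simp [hr, hq0]
  have h49 : (49 : K) ≠ 0 := by norm_num
  have hA : 2401 * r ^ 2 + 245 * r + 1 = (p ^ 2 + 5 * p * q + q ^ 2) / q ^ 2 := by
    rw [hr]; field_simp; ring
  have hB : 49 * r ^ 2 + 13 * r + 1 = (p ^ 2 + 13 * p * q + 49 * q ^ 2) / (49 * q ^ 2) := by
    rw [hr]; field_simp; try ring
  rw [hA, hB, hr]
  generalize p ^ 2 + 5 * p * q + q ^ 2 = a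
  generalize p ^ 2 + 13 * p * q + 49 * q ^ 2 = b
  field_simp

/-- With `r = (t³−8t²+5t+1)/(49t(t−1))` (the hauptmodul of `Γ₀(7)` in terms of the
hauptmodul `t` of `Γ₁(7)`), applying the degree-8 map `φ₃ : X₀(7) → X₀(1)` to `r` gives the
j-invariant of Tate's `Γ₁(7)` curve:
`(2401r² + 245r + 1)³(49r² + 13r + 1)/r
  = (t²−t+1)³(t⁶−11t⁵+30t⁴−15t³−10t²+5t+1)³ / (t⁷(t−1)⁷(t³−8t²+5t+1))`. -/
theorem hauptmodul_tower_identity :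
    let r : RatFunc ℚ := (t ^ 3 - 8 * t ^ 2 + 5 * t + 1) / (49 * t * (t - 1))
    (2401 * r ^ 2 + 245 * r + 1) ^ 3 * (49 * r ^ 2 + 13 * r + 1) / r
      = (t ^ 2 - t + 1) ^ 3 *
          (t ^ 6 - 11 * t ^ 5 + 30 * t ^ 4 - 15 * t ^ 3 - 10 * t ^ 2 + 5 * t + 1) ^ 3 /
        (t ^ 7 * (t - 1) ^ 7 * (t ^ 3 - 8 * t ^ 2 + 5 * t + 1)) := by
  intro r
  rw [tower_aux t _ _ r rfl rfl (by simp only [r, mul_assoc]), mul_pow]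
end
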